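/- Let c = (c₁,c₂) ∈ ℂ². There is no pair (f₁,f₂) of transcendental entire functions of finite order on ℂ² satisfying, for all z = (z₁,z₂) ∈ ℂ², the system f₁(z)² + (f₂(z+c) − f₂(z))² = 1 and f₂(z)² + (f₁(z+c) − f₁(z))² = 1. -/

import Mathlib

/-- A function on ℂ² is entire if it is holomorphic everywhere. -/
def Entire2 (f : ℂ × ℂ → ℂ) : Prop := Differentiable ℂ f

/-- A function on ℂ² is transcendental if it is not a polynomial function. -/
def Transcendental2 (f : ℂ × ℂ → ℂ) : Prop :=
  ¬ ∃ p : MvPolynomial (Fin 2) ℂ, ∀ z : ℂ × ℂ, f z = MvPolynomial.eval ![z.1, z.2] p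

/-- A function on ℂ² is of finite order if |f(z)| ≤ exp(‖z‖^ρ) for all large ‖z‖. -/
def FiniteOrder2 (f : ℂ × ℂ → ℂ) : Prop :=
  ∃ ρ > (0 : ℝ), ∃ R > (0 : ℝ), ∀ z : ℂ × ℂ, R ≤ ‖z‖ → ‖f z‖ ≤ Real.exp (‖z‖ ^ ρ)

open Polynomial in
/-- The coefficient of `exp k` in the derivative of `a * exp k`. -/
noncomputable def expDeriv (k a : ℂ[X]) : ℂ[X] := derivative a + derivative k * a

open Polynomial in
theorem eq_zero_of_expDeriv_eq_zero {k a : ℂ[X]} (hk : derivative k ≠ 0)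
    (h : expDeriv k a = 0) : a = 0 := by
  by_contra ha
  have h1 : derivative a = -(derivative k * a) := eq_neg_of_add_eq_zero_left h
  have h2 := degree_derivative_lt ha
  rw [h1, degree_neg, mul_comm] at h2
  exact absurd h2 (not_lt.mpr (degree_le_mul_left a hk))

open Polynomial in
/-- The exponential sum `∑ a * exp k` over the pairs `(a, k)` in `l`. -/
noncomputable def expSum (l : List (ℂ[X] × ℂ[X])) (t : ℂ) : ℂ :=
  (l.map fun x => x.1.eval t * Complex.exp (x.2.eval t)).sum

open Polynomial in
theorem hasDerivAt_expSum (l : List (ℂ[X] × ℂ[X])) (t : ℂ) :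
    HasDerivAt (expSum l) (expSum (l.map fun x => (expDeriv x.2 x.1, x.2)) t) t := by
  induction l with
  | nil => exact hasDerivAt_const t (0 : ℂ)
  | cons x l ih =>
    have h := ((x.1.hasDerivAt t).mul (x.2.hasDerivAt t).cexp).add ih
    have e : expSum (x :: l) =
        (fun t => x.1.eval t * Complex.exp (x.2.eval t)) + expSum l := by
      ext t; simp [expSum]
    rw [e]
    refine h.congr_deriv ?_
    simp only [expSum, expDeriv, List.map_cons, List.sum_cons, eval_add, eval_mul]
    ring

open Polynomial in
theorem expSum_map_expDeriv_sub (l : List (ℂ[X] × ℂ[X])) (s : ℂ[X]) (t : ℂ) :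
    expSum (l.map fun x => (expDeriv (x.2 - s) x.1, x.2)) t =
      expSum (l.map fun x => (expDeriv x.2 x.1, x.2)) t - (derivative s).eval t * expSum l t := by
  induction l with
  | nil => simp [expSum]
  | cons x l ih =>
    simp only [expSum, List.map_cons, List.sum_cons] at ih ⊢
    rw [ih]
    simp only [expDeriv, eval_add, eval_mul, derivative_sub, eval_sub]
    ring

open Polynomial in
theorem expSum_iterate_expDeriv_eq_zero {l : List (ℂ[X] × ℂ[X])} (h : ∀ t, expSum l t = 0)
    (s : ℂ[X]) (n : ℕ) (t : ℂ) :
    expSum (l.map fun x => ((expDeriv (x.2 - s))^[n] x.1, x.2)) t = 0 := by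
  induction n generalizing t with
  | zero => simpa using h t
  | succ n ih =>
    set l' := l.map fun x => ((expDeriv (x.2 - s))^[n] x.1, x.2) with hl'
    have e : (l.map fun x => ((expDeriv (x.2 - s))^[n + 1] x.1, x.2)) =
        l'.map fun x => (expDeriv (x.2 - s) x.1, x.2) := by
      simp [hl', Function.iterate_succ_apply']
    have hd := hasDerivAt_expSum l' t
    rw [show expSum l' = fun _ => 0 from funext ih] at hd
    rw [e, expSum_map_expDeriv_sub, ih, hd.unique (hasDerivAt_const t (0 : ℂ))]
    simp

open Polynomial in
/-- In a vanishing exponential sum, a term whose exponent differs from all the others by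
nonconstant polynomials has zero coefficient. -/
theorem eq_zero_of_expSum_cons_eq_zero {l : List (ℂ[X] × ℂ[X])} {a r : ℂ[X]}
    (hl : ∀ x ∈ l, derivative x.2 ≠ derivative r) (h : ∀ t, expSum ((a, r) :: l) t = 0) :
    a = 0 := by
  induction hn : l.length generalizing a l with
  | zero =>
    obtain rfl := List.length_eq_zero_iff.mp hn
    refine funext fun t => ?_
    simpa [expSum] using h t
  | succ m ih =>
    obtain ⟨⟨b, s⟩, l, rfl⟩ := List.exists_cons_of_length_eq_add_one hn
    have hs : derivative (r - s) ≠ 0 := by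
      rw [derivative_sub, sub_ne_zero]
      exact (hl (b, s) (by simp)).symm
    suffices hz : ∀ n, (expDeriv (r - s))^[n] a = 0 → a = 0 by
      refine hz (b.natDegree + 1) ?_
      refine ih (l := l.map fun x => ((expDeriv (x.2 - s))^[b.natDegree + 1] x.1, x.2)) ?_ ?_ (by simpa using hn)
      · intro x hx
        obtain ⟨y, hy, rfl⟩ := List.mem_map.mp hx
        exact hl y (List.mem_cons_of_mem _ hy)
      · intro t
        have hb : (expDeriv (s - s))^[b.natDegree + 1] b = 0 := by
          rw [show expDeriv (s - s) = derivative by ext1 x; simp [expDeriv]]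
          exact iterate_derivative_eq_zero (Nat.lt_succ_self _)
        have h' := expSum_iterate_expDeriv_eq_zero h s (b.natDegree + 1) t
        simp only [List.map_cons, hb] at h'
        simpa [expSum] using h'
    intro n
    induction n with
    | zero => exact id
    | succ n ihn =>
      rw [Function.iterate_succ_apply']
      exact fun h0 => ihn (eq_zero_of_expDeriv_eq_zero hs h0)

/-- Growth at most that of the exponential of a polynomial in the norm. -/
def ExpPolyGrowth {E : Type*} [NormedAddCommGroup E] (f : E → ℂ) : Prop :=
  ∃ K : ℝ, 0 ≤ K ∧ ∃ n : ℕ, ∀ z, ‖f z‖ ≤ Real.exp (K * (1 + ‖z‖) ^ n)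

theorem ExpPolyGrowth.add {E : Type*} [NormedAddCommGroup E] {f g : E → ℂ}
    (hf : ExpPolyGrowth f) (hg : ExpPolyGrowth g) : ExpPolyGrowth fun z => f z + g z := by
  obtain ⟨K, hK, n, hf⟩ := hf
  obtain ⟨L, hL, m, hg⟩ := hg
  refine ⟨1 + K + L, by positivity, n + m, fun z => ?_⟩
  have h1 : 1 ≤ 1 + ‖z‖ := by simp
  have hX : 1 ≤ (1 + ‖z‖) ^ (n + m) := one_le_pow₀ h1
  have hn : K * (1 + ‖z‖) ^ n ≤ K * (1 + ‖z‖) ^ (n + m) := by gcongr; simp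
  have hm : L * (1 + ‖z‖) ^ m ≤ L * (1 + ‖z‖) ^ (n + m) := by gcongr; simp
  have hKX : 0 ≤ K * (1 + ‖z‖) ^ (n + m) := by positivity
  have hLX : 0 ≤ L * (1 + ‖z‖) ^ (n + m) := by positivity
  set x := (1 + ‖z‖) ^ (n + m)
  calc ‖f z + g z‖ ≤ ‖f z‖ + ‖g z‖ := norm_add_le _ _
    _ ≤ Real.exp (K * x + L * x) + Real.exp (K * x + L * x) := by
        refine add_le_add ((hf z).trans ?_) ((hg z).trans ?_) <;>
          exact Real.exp_le_exp.mpr (by linarith)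
    _ = 2 * Real.exp (K * x + L * x) := by ring
    _ ≤ Real.exp 1 * Real.exp (K * x + L * x) := by
        gcongr; linarith [Real.add_one_le_exp 1]
    _ = Real.exp (1 + (K * x + L * x)) := (Real.exp_add _ _).symm
    _ ≤ Real.exp ((1 + K + L) * x) := Real.exp_le_exp.mpr (by nlinarith)

theorem ExpPolyGrowth.of_norm_le {E : Type*} [NormedAddCommGroup E] {f g : E → ℂ}
    (hf : ExpPolyGrowth f) (h : ∀ z, ‖g z‖ ≤ ‖f z‖) : ExpPolyGrowth g := by
  obtain ⟨K, hK, n, hf⟩ := hf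
  exact ⟨K, hK, n, fun z => (h z).trans (hf z)⟩

theorem ExpPolyGrowth.comp_line {f : ℂ × ℂ → ℂ} (hf : ExpPolyGrowth f) (w c : ℂ × ℂ) :
    ExpPolyGrowth fun t : ℂ => f (w + t • c) := by
  obtain ⟨K, hK, n, hf⟩ := hf
  refine ⟨K * (1 + ‖w‖ + ‖c‖) ^ n, by positivity, n, fun t => (hf _).trans ?_⟩
  rw [mul_assoc, ← mul_pow]
  gcongr
  have h1 := norm_add_le w (t • c)
  rw [norm_smul] at h1
  nlinarith [norm_nonneg w, norm_nonneg c, norm_nonneg t,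
    mul_nonneg (norm_nonneg w) (norm_nonneg t)]

theorem FiniteOrder2.expPolyGrowth {f : ℂ × ℂ → ℂ} (hf : FiniteOrder2 f) (hc : Continuous f) :
    ExpPolyGrowth f := by
  obtain ⟨ρ, hρ, R, -, h⟩ := hf
  obtain ⟨M, hM⟩ := (isCompact_closedBall (0 : ℂ × ℂ) R).exists_bound_of_continuousOn
    hc.continuousOn
  refine ⟨|M| + 1, by positivity, ⌈ρ⌉₊, fun z => ?_⟩
  have h1 : 1 ≤ 1 + ‖z‖ := by simp
  have hX : 1 ≤ (1 + ‖z‖) ^ ⌈ρ⌉₊ := one_le_pow₀ h1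
  rcases le_total R ‖z‖ with hz | hz
  · refine (h z hz).trans (Real.exp_le_exp.mpr ?_)
    have : ‖z‖ ^ ρ ≤ (1 + ‖z‖) ^ ⌈ρ⌉₊ := by
      rw [← Real.rpow_natCast]
      calc ‖z‖ ^ ρ ≤ (1 + ‖z‖) ^ ρ := by
            gcongr; linarith
        _ ≤ _ := Real.rpow_le_rpow_of_exponent_le h1 (Nat.le_ceil ρ)
    nlinarith [abs_nonneg M]
  · calc ‖f z‖ ≤ M := hM z (by simpa using hz)
      _ ≤ |M| + 1 := (le_abs_self M).trans (by simp)
      _ ≤ (|M| + 1) * (1 + ‖z‖) ^ ⌈ρ⌉₊ := le_mul_of_one_le_right (by positivity) hX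
      _ ≤ _ := by linarith [Real.add_one_le_exp ((|M| + 1) * (1 + ‖z‖) ^ ⌈ρ⌉₊)]

open Polynomial in
theorem exists_polynomial_of_growth {h : ℂ → ℂ} (hd : Differentiable ℂ h) {K : ℝ} (n : ℕ)
    (hK : ∀ z, ‖h z‖ ≤ K * (1 + ‖z‖) ^ n) : ∃ p : ℂ[X], ∀ z, h z = p.eval z := by
  have hK0 : 0 ≤ K := by simpa using (norm_nonneg _).trans (hK 0)
  have hz : ∀ m, n < m → iteratedDeriv m h 0 = 0 := by
    intro m hm
    have key : ∀ R : ℝ, 1 ≤ R → ‖iteratedDeriv m h 0‖ ≤ (m.factorial * (K * 2 ^ n)) / R := by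
      intro R hR
      have hR0 : 0 < R := by linarith
      refine (Complex.norm_iteratedDeriv_le_of_forall_mem_sphere_norm_le m hR0
        (hd.diffContOnCl) (C := K * (2 * R) ^ n) fun z hz => (hK z).trans ?_).trans ?_
      · have : ‖z‖ = R := by simpa using hz
        rw [this]; gcongr; linarith
      · rw [div_le_div_iff₀ (by positivity) hR0, mul_pow]
        have : R ^ (n + 1) ≤ R ^ m := pow_le_pow_right₀ hR hm
        calc (m.factorial : ℝ) * (K * (2 ^ n * R ^ n)) * R
            = m.factorial * (K * 2 ^ n) * R ^ (n + 1) := by ring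
          _ ≤ _ := by gcongr
    have ht : Filter.Tendsto (fun R : ℝ => (m.factorial * (K * 2 ^ n)) / R) Filter.atTop (nhds 0) :=
      tendsto_const_nhds.div_atTop Filter.tendsto_id
    have := ge_of_tendsto ht (Filter.eventually_atTop.mpr ⟨1, key⟩)
    simpa using this
  refine ⟨∑ i ∈ Finset.range (n + 1), C ((i.factorial : ℂ)⁻¹ * iteratedDeriv i h 0) * X ^ i,
    fun z => ?_⟩
  rw [← Complex.taylorSeries_eq_of_entire' 0 z hd, tsum_eq_sum (s := Finset.range (n + 1))]
  · simp [eval_finsetSum]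
  · intro m hm
    rw [hz m (by rw [Finset.mem_range] at hm; omega)]
    simp

theorem exists_exp_eq {u : ℂ → ℂ} (hu : Differentiable ℂ u) (h0 : ∀ z, u z ≠ 0) :
    ∃ h : ℂ → ℂ, Differentiable ℂ h ∧ ∀ z, u z = Complex.exp (h z) := by
  have hd : Differentiable ℂ fun z => deriv u z / u z := by
    have : Differentiable ℂ (deriv u) := fun z =>
      (hu.analyticAt z).deriv.differentiableAt
    exact this.div hu h0
  obtain ⟨h, hh0, hh⟩ := hd.isExactOn_univ.with_val_at 0 (Complex.log (u 0))
  have hdh : Differentiable ℂ h := fun z => (hh z trivial).differentiableAt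
  refine ⟨h, hdh, fun z => ?_⟩
  have hder : ∀ x, HasDerivAt (fun z => u z * Complex.exp (-h z)) 0 x := by
    intro x
    refine ((hu x).hasDerivAt.mul (hh x trivial).neg.cexp).congr_deriv ?_
    have := h0 x
    field_simp
    ring
  have hc := is_const_of_deriv_eq_zero (fun x => (hder x).differentiableAt)
    (fun x => (hder x).deriv) z 0
  simp only [hh0, Complex.exp_neg, Complex.exp_log (h0 0), mul_inv_cancel₀ (h0 0)] at hc
  exact (mul_inv_eq_one₀ (Complex.exp_ne_zero _)).mp hc

open Polynomial in
/-- A zero-free entire function of finite order is the exponential of a polynomial. -/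
theorem ExpPolyGrowth.exists_polynomial {u : ℂ → ℂ} (hu : ExpPolyGrowth u)
    (hd : Differentiable ℂ u) (h0 : ∀ z, u z ≠ 0) :
    ∃ p : ℂ[X], ∀ z, u z = Complex.exp (p.eval z) := by
  obtain ⟨h, hh, he⟩ := exists_exp_eq hd h0
  obtain ⟨K, hK, n, hb⟩ := hu
  have hre : ∀ z, (h z).re ≤ K * (1 + ‖z‖) ^ n := fun z => by
    have := hb z
    rwa [he, Complex.norm_exp, Real.exp_le_exp] at this
  obtain ⟨p, hp⟩ := exists_polynomial_of_growth hh (K := 2 * (K + 1) * 2 ^ n + 3 * ‖h 0‖) n <| by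
    intro z
    have hz := norm_nonneg z
    have h1 : 1 ≤ (1 + ‖z‖) ^ n := one_le_pow₀ (by simp)
    have hM : 0 < (K + 1) * (2 + 2 * ‖z‖) ^ n := by positivity
    refine (Complex.borelCaratheodory (R := 2 * ‖z‖ + 1) hM hh.differentiableOn ?_
      (by linarith) (by rw [mem_ball_zero_iff]; linarith)).trans ?_
    · intro x hx
      rw [mem_ball_zero_iff] at hx
      have h2 : 1 + ‖x‖ ≤ 2 + 2 * ‖z‖ := by linarith
      refine (hre x).trans ?_
      gcongr
      linarith
    · have e1 : 2 * ((K + 1) * (2 + 2 * ‖z‖) ^ n) * ‖z‖ / (2 * ‖z‖ + 1 - ‖z‖) ≤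
          2 * ((K + 1) * (2 + 2 * ‖z‖) ^ n) := by
        rw [div_le_iff₀ (by linarith)]
        gcongr
        linarith
      have e2 : ‖h 0‖ * (2 * ‖z‖ + 1 + ‖z‖) / (2 * ‖z‖ + 1 - ‖z‖) ≤ 3 * ‖h 0‖ := by
        rw [div_le_iff₀ (by linarith)]
        nlinarith [norm_nonneg (h 0)]
      have e3 : (2 + 2 * ‖z‖) ^ n = 2 ^ n * (1 + ‖z‖) ^ n := by rw [← mul_pow]; ring
      rw [e3] at e1 ⊢
      nlinarith [mul_le_mul_of_nonneg_left h1 (norm_nonneg (h 0))]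
  exact ⟨p, fun z => by rw [he, hp]⟩

open Polynomial in
theorem derivative_taylor_ne_zero {p : ℂ[X]} (hp : derivative p ≠ 0) (r : ℂ) :
    derivative (taylor r p) ≠ 0 := by
  rwa [Ne, derivative_eq_zero, natDegree_taylor, ← derivative_eq_zero]

open Polynomial in
theorem derivative_taylor_ne_neg {p : ℂ[X]} (hp : derivative p ≠ 0) (r : ℂ) :
    derivative (taylor r p) ≠ -derivative p := by
  intro h
  have hn : p.natDegree ≠ 0 := by rwa [Ne, ← derivative_eq_zero]
  have h0 := eq_C_of_derivative_eq_zero (p := taylor r p + p) (by rw [derivative_add, h]; simp)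
  have h1 := congrArg (fun f => f.coeff p.natDegree) h0
  simp only [coeff_add, coeff_taylor_natDegree, coeff_natDegree, coeff_C, hn, if_false] at h1
  have h2 : p.leadingCoeff = 0 := by linear_combination h1 / 2
  exact hp (by simp [leadingCoeff_eq_zero.mp h2])

open Polynomial in
theorem exists_eq_add_C_of_derivative_eq {p q : ℂ[X]} (h : derivative p = derivative q) :
    ∃ b, p = q + C b := by
  refine ⟨(p - q).coeff 0, ?_⟩
  rw [← eq_C_of_derivative_eq_zero (p := p - q) (by rw [derivative_sub, h, sub_self])]
  ring

open Polynomial in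
theorem eq_zero_of_mul_exp_add_mul_exp_neg {p : ℂ[X]} (hp : derivative p ≠ 0) {a b : ℂ}
    (h : ∀ t, a * Complex.exp (p.eval t) + b * Complex.exp (-p.eval t) = 0) : a = 0 ∧ b = 0 := by
  have hne : derivative p ≠ -derivative p := fun h => hp (self_eq_neg.mp h)
  constructor
  · refine C_eq_zero.mp (eq_zero_of_expSum_cons_eq_zero (l := [(C b, -p)]) (r := p) ?_ ?_)
    · simpa using hne.symm
    · intro t
      simpa [expSum] using h t
  · refine C_eq_zero.mp (eq_zero_of_expSum_cons_eq_zero (l := [(C a, p)]) (r := -p) ?_ ?_)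
    · simpa using hne
    · intro t
      simpa [expSum, add_comm] using h t

open Polynomial in
theorem derivative_eq_of_expSum {P p q : ℂ[X]} (hP : derivative P ≠ 0) (hp : derivative p ≠ 0)
    (hq : derivative q ≠ 0) (hPp : derivative P ≠ -derivative p)
    (h : ∀ t, Complex.exp (P.eval t) + Complex.exp (-P.eval t)
      - Complex.exp (p.eval t) - Complex.exp (-p.eval t)
      + Complex.I * (Complex.exp (q.eval t) - Complex.exp (-q.eval t)) = 0) :
    derivative P = derivative p ∧
      (derivative q = derivative p ∨ derivative q = -derivative p) := by
  have hP' : -derivative P ≠ derivative P := fun h => hP (neg_eq_self.mp h)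
  have hp' : -derivative p ≠ derivative p := fun h => hp (neg_eq_self.mp h)
  have hq' : -derivative q ≠ derivative q := fun h => hq (neg_eq_self.mp h)
  have hqp : derivative q = derivative p ∨ derivative q = -derivative p := by
    by_contra! hc
    obtain ⟨hc1, hc2⟩ := hc
    by_cases hPe : derivative P = derivative p
    · have h0 := eq_zero_of_expSum_cons_eq_zero (a := C Complex.I) (r := q)
        (l := [(1, P), (1, -P), (-1, p), (-1, -p), (-C Complex.I, -q)])
        (by
          simp only [List.mem_cons, List.not_mem_nil, or_false, forall_eq_or_imp, forall_eq,
            derivative_neg]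
          grind)
        (fun t => by
          simp only [expSum, List.map_cons, List.sum_cons, List.map_nil, List.sum_nil, eval_neg,
            eval_one, eval_C]
          linear_combination h t)
      simp at h0
    · have h0 := eq_zero_of_expSum_cons_eq_zero (a := -1) (r := p)
        (l := [(1, P), (1, -P), (-1, -p), (C Complex.I, q), (-C Complex.I, -q)])
        (by
          simp only [List.mem_cons, List.not_mem_nil, or_false, forall_eq_or_imp, forall_eq,
            derivative_neg]
          grind)
        (fun t => by
          simp only [expSum, List.map_cons, List.sum_cons, List.map_nil, List.sum_nil, eval_neg,
            eval_one, eval_C]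
          linear_combination h t)
      simp at h0
  refine ⟨?_, hqp⟩
  by_contra hc
  have h0 := eq_zero_of_expSum_cons_eq_zero (a := 1) (r := P)
    (l := [(1, -P), (-1, p), (-1, -p), (C Complex.I, q), (-C Complex.I, -q)])
    (by
      simp only [List.mem_cons, List.not_mem_nil, or_false, forall_eq_or_imp, forall_eq,
        derivative_neg]
      grind)
    (fun t => by
      simp only [expSum, List.map_cons, List.sum_cons, List.map_nil, List.sum_nil, eval_neg,
        eval_one, eval_C]
      linear_combination h t)
  simp at h0

open Polynomial in
theorem not_exp_system {p q : ℂ[X]} (hp : derivative p ≠ 0) (hq : derivative q ≠ 0)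
    (h1 : ∀ t, Complex.exp (p.eval (t + 1)) + Complex.exp (-p.eval (t + 1))
      - Complex.exp (p.eval t) - Complex.exp (-p.eval t)
      + Complex.I * (Complex.exp (q.eval t) - Complex.exp (-q.eval t)) = 0)
    (h2 : ∀ t, Complex.exp (q.eval (t + 1)) + Complex.exp (-q.eval (t + 1))
      - Complex.exp (q.eval t) - Complex.exp (-q.eval t)
      + Complex.I * (Complex.exp (p.eval t) - Complex.exp (-p.eval t)) = 0) : False := by
  obtain ⟨hPd, hqd⟩ := derivative_eq_of_expSum (derivative_taylor_ne_zero hp 1) hp hq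
    (derivative_taylor_ne_neg hp 1) (fun t => by simpa only [taylor_eval] using h1 t)
  obtain ⟨a, ha⟩ := exists_eq_add_C_of_derivative_eq hPd
  have hshift : ∀ t, p.eval (t + 1) = p.eval t + a := fun t => by
    rw [← taylor_eval, ha, eval_add, eval_C]
  have hA : Complex.exp a * Complex.exp (-a) = 1 := by rw [← Complex.exp_add]; simp
  have hI := Complex.I_sq
  rcases hqd with hqd | hqd
  · obtain ⟨b, rfl⟩ := exists_eq_add_C_of_derivative_eq hqd
    have hB : Complex.exp b * Complex.exp (-b) = 1 := by rw [← Complex.exp_add]; simp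
    simp only [eval_add, eval_C, hshift, neg_add, Complex.exp_add] at h1 h2
    obtain ⟨e1, e2⟩ := eq_zero_of_mul_exp_add_mul_exp_neg hp
      (a := Complex.exp a - 1 + Complex.I * Complex.exp b)
      (b := Complex.exp (-a) - 1 - Complex.I * Complex.exp (-b))
      (fun t => by linear_combination h1 t)
    obtain ⟨e3, -⟩ := eq_zero_of_mul_exp_add_mul_exp_neg hp
      (a := Complex.exp a * Complex.exp b - Complex.exp b + Complex.I)
      (b := Complex.exp (-a) * Complex.exp (-b) - Complex.exp (-b) - Complex.I)
      (fun t => by linear_combination h2 t)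
    generalize Complex.exp a = A at *
    generalize Complex.exp b = B at *
    generalize Complex.exp (-a) = A' at *
    generalize Complex.exp (-b) = B' at *
    have hB2 : B ^ 2 = 1 := by
      linear_combination (-Complex.I) * (B * e1 - e3) + (B ^ 2 - 1) * hI
    have hBB : B' = B := by linear_combination B * hB - B' * hB2
    subst hBB
    have hA1 : A = 1 - Complex.I * B' := by linear_combination e1
    have hA2 : A' = 1 + Complex.I * B' := by linear_combination e2
    rw [hA1, hA2] at hA
    have : (1 : ℂ) = 0 := by linear_combination hA + B' ^ 2 * hI - hB2
    exact one_ne_zero this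
  · obtain ⟨b, rfl⟩ := exists_eq_add_C_of_derivative_eq (q := -p) (by rw [hqd, derivative_neg])
    have hB : Complex.exp b * Complex.exp (-b) = 1 := by rw [← Complex.exp_add]; simp
    simp only [eval_add, eval_neg, eval_C, hshift, neg_add, neg_neg, Complex.exp_add] at h1 h2
    obtain ⟨e1, e2⟩ := eq_zero_of_mul_exp_add_mul_exp_neg hp
      (a := Complex.exp a - 1 - Complex.I * Complex.exp (-b))
      (b := Complex.exp (-a) - 1 + Complex.I * Complex.exp b)
      (fun t => by linear_combination h1 t)
    obtain ⟨e3, -⟩ := eq_zero_of_mul_exp_add_mul_exp_neg hp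
      (a := Complex.exp a * Complex.exp (-b) - Complex.exp (-b) + Complex.I)
      (b := Complex.exp (-a) * Complex.exp b - Complex.exp b - Complex.I)
      (fun t => by linear_combination h2 t)
    generalize Complex.exp a = A at *
    generalize Complex.exp b = B at *
    generalize Complex.exp (-a) = A' at *
    generalize Complex.exp (-b) = B' at *
    have hB2 : B' ^ 2 = -1 := by
      linear_combination (Complex.I) * (B' * e1 - e3) + (B' ^ 2 + 1) * hI
    have hBB : B = -B' := by linear_combination -B' * hB + B * hB2
    subst hBB
    have hA1 : A = 1 + Complex.I * B' := by linear_combination e1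
    have hA2 : A' = 1 + Complex.I * B' := by linear_combination e2
    rw [hA1, hA2] at hA
    have h3 : 2 * Complex.I * B' = -1 := by
      linear_combination hA - B' ^ 2 * hI + hB2
    have : (3 : ℂ) = 0 := by
      linear_combination (2 * Complex.I * B' - 1) * h3 - 4 * B' ^ 2 * hI + 4 * hB2
    norm_num at this

open Polynomial in
theorem derivative_eq_zero_of_exp_eq_exp_neg {p : ℂ[X]}
    (h : ∀ t, Complex.exp (p.eval t) = Complex.exp (-p.eval t)) : derivative p = 0 := by
  by_contra hp
  have := (eq_zero_of_mul_exp_add_mul_exp_neg hp (a := 1) (b := -1)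
    fun t => by linear_combination h t).1
  exact one_ne_zero this

open Polynomial in
/-- Finite order entire `g` and `d` with `g ^ 2 + d ^ 2 = 1` are the cosine and sine of a
polynomial. -/
theorem exists_polynomial_of_sq_add_sq_eq_one {g d : ℂ → ℂ} (hg : Differentiable ℂ g)
    (hd : Differentiable ℂ d) (hgrow : ExpPolyGrowth fun t => g t + Complex.I * d t)
    (h : ∀ t, g t ^ 2 + d t ^ 2 = 1) :
    ∃ p : ℂ[X], ∀ t, 2 * g t = Complex.exp (p.eval t) + Complex.exp (-p.eval t) ∧
      2 * d t = -Complex.I * (Complex.exp (p.eval t) - Complex.exp (-p.eval t)) := by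
  have hmul : ∀ t, (g t + Complex.I * d t) * (g t - Complex.I * d t) = 1 := fun t => by
    linear_combination h t - d t ^ 2 * Complex.I_sq
  obtain ⟨p, hp⟩ := hgrow.exists_polynomial (by fun_prop)
    (fun t => left_ne_zero_of_mul_eq_one (hmul t))
  refine ⟨p, fun t => ?_⟩
  have h1 : Complex.exp (-p.eval t) = g t - Complex.I * d t := by
    rw [Complex.exp_neg, ← hp t]
    exact (eq_inv_of_mul_eq_one_right (hmul t)).symm
  rw [h1, ← hp t]
  exact ⟨by ring, by linear_combination 2 * d t * Complex.I_sq⟩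

theorem eq_add_one_of_sq_add_sq_eq_one {g₁ g₂ : ℂ → ℂ} (hd₁ : Differentiable ℂ g₁)
    (hd₂ : Differentiable ℂ g₂)
    (hgrow₁ : ExpPolyGrowth fun t => g₁ t + Complex.I * (g₂ (t + 1) - g₂ t))
    (hgrow₂ : ExpPolyGrowth fun t => g₂ t + Complex.I * (g₁ (t + 1) - g₁ t))
    (h₁ : ∀ t, g₁ t ^ 2 + (g₂ (t + 1) - g₂ t) ^ 2 = 1)
    (h₂ : ∀ t, g₂ t ^ 2 + (g₁ (t + 1) - g₁ t) ^ 2 = 1) (t : ℂ) : g₂ (t + 1) = g₂ t := by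
  obtain ⟨p, hp⟩ := exists_polynomial_of_sq_add_sq_eq_one hd₁ (by fun_prop) hgrow₁ h₁
  obtain ⟨q, hq⟩ := exists_polynomial_of_sq_add_sq_eq_one hd₂ (by fun_prop) hgrow₂ h₂
  have e₁ : ∀ t, Complex.exp (p.eval (t + 1)) + Complex.exp (-p.eval (t + 1))
      - Complex.exp (p.eval t) - Complex.exp (-p.eval t)
      + Complex.I * (Complex.exp (q.eval t) - Complex.exp (-q.eval t)) = 0 := fun t => by
    linear_combination (hq t).2 + (hp t).1 - (hp (t + 1)).1
  have e₂ : ∀ t, Complex.exp (q.eval (t + 1)) + Complex.exp (-q.eval (t + 1))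
      - Complex.exp (q.eval t) - Complex.exp (-q.eval t)
      + Complex.I * (Complex.exp (p.eval t) - Complex.exp (-p.eval t)) = 0 := fun t => by
    linear_combination (hp t).2 + (hq t).1 - (hq (t + 1)).1
  have hshift : ∀ r : Polynomial ℂ, r.derivative = 0 → ∀ t, r.eval (t + 1) = r.eval t := by
    intro r hr t
    rw [Polynomial.eq_C_of_derivative_eq_zero hr]
    simp
  have hqz : q.derivative = 0 := by
    by_cases hpz : p.derivative = 0
    · refine derivative_eq_zero_of_exp_eq_exp_neg fun t => ?_
      have := e₁ t
      rw [hshift p hpz] at this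
      refine sub_eq_zero.mp ((mul_eq_zero.mp ?_).resolve_left Complex.I_ne_zero)
      linear_combination this
    · by_contra hqz
      exact not_exp_system hpz hqz e₁ e₂
  have := (hq (t + 1)).1
  rw [hshift q hqz, ← (hq t).1] at this
  exact mul_left_cancel₀ two_ne_zero this

theorem not_transcendental2_of_sq_eq_one {f : ℂ × ℂ → ℂ} (hf : Continuous f)
    (h : ∀ z, f z ^ 2 = 1) : ¬ Transcendental2 f := by
  refine not_not.mpr ?_
  rcases isPreconnected_univ.eq_one_or_eq_neg_one_of_sq_eq hf.continuousOn
    (fun z _ => h z) with h1 | h1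
  · exact ⟨1, fun z => by simpa using h1 (Set.mem_univ z)⟩
  · exact ⟨-1, fun z => by simpa using h1 (Set.mem_univ z)⟩

theorem stmt_0 (c : ℂ × ℂ) :
    ¬ ∃ f₁ f₂ : ℂ × ℂ → ℂ,
      Entire2 f₁ ∧ Transcendental2 f₁ ∧ FiniteOrder2 f₁ ∧
      Entire2 f₂ ∧ Transcendental2 f₂ ∧ FiniteOrder2 f₂ ∧
      (∀ z : ℂ × ℂ, f₁ z ^ 2 + (f₂ (z + c) - f₂ z) ^ 2 = 1) ∧
      (∀ z : ℂ × ℂ, f₂ z ^ 2 + (f₁ (z + c) - f₁ z) ^ 2 = 1) := by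
  rintro ⟨f₁, f₂, hd₁, ht₁, ho₁, hd₂, -, ho₂, h₁, h₂⟩
  unfold Entire2 at hd₁ hd₂
  refine not_transcendental2_of_sq_eq_one hd₁.continuous (fun w => ?_) ht₁
  have hline : ∀ t : ℂ, w + (t + 1) • c = w + t • c + c := fun t => by
    rw [add_smul, one_smul, add_assoc]
  have hgrow : ∀ f g : ℂ × ℂ → ℂ, Continuous f → Continuous g → FiniteOrder2 f →
      FiniteOrder2 g → ExpPolyGrowth fun t : ℂ =>
        f (w + t • c) + Complex.I * (g (w + (t + 1) • c) - g (w + t • c)) := by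
    intro f g hfc hgc hf hg
    have hg' := hg.expPolyGrowth hgc
    have a := (hf.expPolyGrowth hfc).comp_line w c
    have b := (hg'.comp_line (w + c) c).of_norm_le
      (g := fun t : ℂ => Complex.I * g (w + (t + 1) • c))
      (fun t => by simp [hline, add_right_comm])
    have d := (hg'.comp_line w c).of_norm_le
      (g := fun t : ℂ => -(Complex.I * g (w + t • c))) (fun t => by simp)
    refine ((a.add b).add d).of_norm_le fun t => le_of_eq (congrArg _ ?_)
    ring
  have key := eq_add_one_of_sq_add_sq_eq_one
    (g₁ := fun t => f₁ (w + t • c)) (g₂ := fun t => f₂ (w + t • c))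
    (by fun_prop) (by fun_prop)
    (hgrow f₁ f₂ hd₁.continuous hd₂.continuous ho₁ ho₂)
    (hgrow f₂ f₁ hd₂.continuous hd₁.continuous ho₂ ho₁)
    (fun t => by simpa only [hline] using h₁ (w + t • c))
    (fun t => by simpa only [hline] using h₂ (w + t • c)) 0
  have h := h₁ w
  simp only [zero_add, one_smul, zero_smul, add_zero] at key
  rw [key] at h
  simpa using h
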